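/- For a compact metric space X and p ≥ 1, the lower metric order of the space of Borel probability measures on X with the p-Wasserstein metric is at least the lower box-counting dimension of X. -/

import Mathlib

open MeasureTheory Filter Metric Set
open scoped NNReal ENNReal

noncomputable section

/-- The set of transport plans (couplings) between two measures. -/
def couplings {X : Type*} [MeasurableSpace X] (μ ν : Measure X) : Set (Measure (X × X)) :=
  {π | π.map Prod.fst = μ ∧ π.map Prod.snd = ν}

/-- The `p`-Wasserstein distance between two measures. -/
noncomputable def Wass {X : Type*} [MetricSpace X] [MeasurableSpace X] (p : ℝ)
    (μ ν : Measure X) : ℝ :=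
  sInf ((fun π : Measure (X × X) => (∫ z, dist z.1 z.2 ^ p ∂π) ^ (1 / p)) '' couplings μ ν)

/-- Covering number: minimal cardinality of an `ε`-dense set. -/
noncomputable def coverNum (X : Type*) [MetricSpace X] (ε : ℝ) : ℕ :=
  sInf {n | ∃ F : Finset X, F.card = n ∧ ∀ x : X, ∃ y ∈ F, dist x y ≤ ε}

/-- Packing number: maximal cardinality of an `ε`-separated set. -/
noncomputable def packNum (X : Type*) [MetricSpace X] (ε : ℝ) : ℕ :=
  sSup {n | ∃ F : Finset X, F.card = n ∧ ∀ x ∈ F, ∀ y ∈ F, x ≠ y → ε < dist x y}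

/-- The (topological) support of a measure. -/
def msupport {X : Type*} [TopologicalSpace X] [MeasurableSpace X] (μ : Measure X) : Set X :=
  {x | ∀ U : Set X, IsOpen U → x ∈ U → 0 < μ U}

/-- Quantization number of `μ` at scale `ε` w.r.t. the `q`-Wasserstein metric. -/
noncomputable def quantW {Y : Type*} [MetricSpace Y] [MeasurableSpace Y] (q : ℝ)
    (μ : Measure Y) (ε : ℝ) : ℕ :=
  sInf {n | ∃ ν : Measure Y, IsProbabilityMeasure ν ∧
    (∃ S : Finset Y, S.card = n ∧ ν (↑S)ᶜ = 0) ∧ Wass q μ ν ≤ ε}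

end

/-- Packing number of a family of measures w.r.t. the `p`-Wasserstein distance. -/
noncomputable def packWass {X : Type*} [MetricSpace X] [MeasurableSpace X] (p : ℝ)
    (C : Set (Measure X)) (ε : ℝ) : ℕ :=
  sSup {n | ∃ F : Finset (Measure X), ↑F ⊆ C ∧ F.card = n ∧
    ∀ μ ∈ F, ∀ ν ∈ F, μ ≠ ν → ε < Wass p μ ν}


lemma aux_ball_card (m : ℕ) (v : Fin m → Bool) :
    ((Finset.univ.filter (fun w : Fin m → Bool => 8 * hammingDist v w < m)).card : ℝ) ^ 8
      ≤ ((3/2 : ℝ) ^ 8 * 2) ^ m := by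
  classical
  have hsum : ∑ w : Fin m → Bool, ((1/2 : ℝ)) ^ hammingDist v w = (3/2 : ℝ) ^ m := by
    have h1 : ∀ w : Fin m → Bool, ((1/2 : ℝ)) ^ hammingDist v w
        = ∏ i, (if v i ≠ w i then (1/2 : ℝ) else 1) := by
      intro w
      rw [Finset.prod_ite]
      simp [hammingDist]
    simp_rw [h1]
    have := (Finset.prod_univ_sum (fun _ : Fin m => (Finset.univ : Finset Bool))
      (fun i b => if v i ≠ b then (1/2 : ℝ) else 1)).symm
    rw [Fintype.piFinset_univ] at this
    rw [this]
    have h2 : ∀ i : Fin m, ∑ b : Bool, (if v i ≠ b then (1/2 : ℝ) else 1) = 3/2 := by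
      intro i
      cases v i <;> norm_num
    rw [Finset.prod_congr rfl (fun i _ => h2 i)]
    simp [div_pow]
  set S := Finset.univ.filter (fun w : Fin m → Bool => 8 * hammingDist v w < m) with hS
  set t : ℝ := (1/2 : ℝ) ^ ((m : ℝ) / 8) with ht
  have ht0 : 0 < t := by positivity
  have ht8 : t ^ 8 = (1/2 : ℝ) ^ m := by
    rw [ht, ← Real.rpow_natCast, ← Real.rpow_mul (by norm_num), ← Real.rpow_natCast]
    congr 1
    push_cast; ring
  have hle : (S.card : ℝ) * t ≤ (3/2 : ℝ) ^ m := by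
    rw [← hsum]
    calc (S.card : ℝ) * t = ∑ w ∈ S, t := by simp
      _ ≤ ∑ w ∈ S, (1/2 : ℝ) ^ hammingDist v w := by
        apply Finset.sum_le_sum
        intro w hw
        have hw' : 8 * hammingDist v w < m := by simpa [hS] using hw
        rw [ht, ← Real.rpow_natCast]
        apply Real.rpow_le_rpow_of_exponent_ge (by norm_num) (by norm_num)
        have : (8 * hammingDist v w : ℝ) < m := by exact_mod_cast hw'
        linarith
      _ ≤ _ := Finset.sum_le_univ_sum_of_nonneg (fun w => by positivity)
  have h8 := pow_le_pow_left₀ (by positivity) hle 8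
  rw [mul_pow, ht8] at h8
  have : (S.card : ℝ) ^ 8 = ((S.card : ℝ) ^ 8 * (1/2) ^ m) * 2 ^ m := by
    rw [mul_assoc, ← mul_pow]; norm_num
  rw [this, mul_pow, ← pow_mul, mul_comm 8 m, pow_mul]
  gcongr

lemma aux_code (m : ℕ) : ∃ C : Finset (Fin m → Bool),
    (∀ v ∈ C, ∀ w ∈ C, v ≠ w → m ≤ 8 * hammingDist v w) ∧
    (m : ℝ) * (Real.log 2 / 4) ≤ Real.log C.card := by
  classical
  obtain ⟨C, hC⟩ := Finset.exists_maximal (s := Finset.univ.filter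
    (fun C : Finset (Fin m → Bool) => ∀ v ∈ C, ∀ w ∈ C, v ≠ w → m ≤ 8 * hammingDist v w))
    ⟨∅, by simp⟩
  have hC1 : ∀ v ∈ C, ∀ w ∈ C, v ≠ w → m ≤ 8 * hammingDist v w := by
    simpa using hC.prop
  refine ⟨C, hC1, ?_⟩
  by_cases hm : m = 0
  · subst hm
    simpa using Real.log_natCast_nonneg C.card
  have hcov : ∀ w, ∃ v ∈ C, 8 * hammingDist v w < m := by
    intro w
    by_contra! hcon
    have hw : w ∉ C := by
      intro hw
      have := hcon w hw
      simp at this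
      omega
    have hins : insert w C ≤ C := by
      apply hC.le_of_ge _ (Finset.subset_insert w C)
      simp only [Finset.mem_filter, Finset.mem_univ, true_and]
      intro a ha b hb hab
      rw [Finset.mem_insert] at ha hb
      rcases ha with rfl | ha <;> rcases hb with rfl | hb
      · exact absurd rfl hab
      · rw [hammingDist_comm]; exact hcon b hb
      · exact hcon a ha
      · exact hC1 a ha b hb hab
    exact hw (hins (Finset.mem_insert_self w C))
  have hpos : 0 < C.card := by
    obtain ⟨v, hv, _⟩ := hcov (fun _ => true)
    exact Finset.card_pos.mpr ⟨v, hv⟩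
  have hsub : (Finset.univ : Finset (Fin m → Bool)) ⊆ C.biUnion
      (fun v => Finset.univ.filter (fun w : Fin m → Bool => 8 * hammingDist v w < m)) := by
    intro w _
    obtain ⟨v, hv, h⟩ := hcov w
    simp only [Finset.mem_biUnion, Finset.mem_filter, Finset.mem_univ, true_and]
    exact ⟨v, hv, h⟩
  set V : ℝ := (((3/2 : ℝ) ^ 8 * 2) ^ m) ^ (1/8 : ℝ) with hV
  have hV8 : V ^ 8 = ((3/2 : ℝ) ^ 8 * 2) ^ m := by
    rw [hV, ← Real.rpow_natCast, ← Real.rpow_mul (by positivity)]; norm_num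
  have hcard : (2 : ℝ) ^ m ≤ C.card * V := by
    have h1 : (2:ℝ)^m = ((Finset.univ : Finset (Fin m → Bool)).card : ℝ) := by simp
    rw [h1]
    have h2 := (Finset.card_le_card hsub).trans Finset.card_biUnion_le
    calc ((Finset.univ : Finset (Fin m → Bool)).card : ℝ) ≤ ∑ v ∈ C, ((Finset.univ.filter (fun w : Fin m → Bool => 8 * hammingDist v w < m)).card : ℝ) := by
          exact_mod_cast h2
      _ ≤ ∑ v ∈ C, V := by
          apply Finset.sum_le_sum
          intro v _
          have := aux_ball_card m v
          rw [← hV8] at this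
          exact le_of_pow_le_pow_left₀ (by norm_num) (by positivity) this
      _ = _ := by simp
  have h8 := pow_le_pow_left₀ (by positivity) hcard 8
  rw [mul_pow, hV8] at h8
  have h9 : (4:ℝ)^m ≤ (C.card:ℝ)^8 := by
    have e1 : ((2:ℝ)^m)^8 = 256^m := by rw [← pow_mul, mul_comm, pow_mul]; norm_num
    have e2 : (4:ℝ)^m * ((3/2 : ℝ) ^ 8 * 2) ^ m ≤ 256^m := by
      rw [← mul_pow]; apply pow_le_pow_left₀ <;> norm_num
    rw [e1] at h8
    exact le_of_mul_le_mul_right (e2.trans h8) (by positivity)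
  have h10 := Real.log_le_log (by positivity) h9
  rw [Real.log_pow, Real.log_pow, show (4:ℝ) = 2^2 by norm_num, Real.log_pow] at h10
  push_cast at h10
  linarith

section aux
set_option linter.unusedSectionVars false
variable {X : Type*} [MetricSpace X] [CompactSpace X] [MeasurableSpace X] [BorelSpace X]

lemma aux_coupling_fin {μ ν : Measure X} [IsFiniteMeasure μ] {π : Measure (X × X)}
    (h : π ∈ couplings μ ν) : π univ = μ univ := by
  rw [← h.1, Measure.map_apply measurable_fst MeasurableSet.univ]; simp

lemma aux_integrable {p : ℝ} (hp : 1 ≤ p) (π : Measure (X × X)) [IsFiniteMeasure π] :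
    Integrable (fun z : X × X => dist z.1 z.2 ^ p) π := by
  have hc : Continuous (fun z : X × X => dist z.1 z.2 ^ p) :=
    continuous_dist.rpow_const (fun _ => Or.inr (by linarith))
  obtain ⟨C, hC⟩ := (isCompact_univ (X := X × X)).exists_bound_of_continuousOn hc.continuousOn
  exact Integrable.of_bound hc.aestronglyMeasurable C (Eventually.of_forall fun z => hC z trivial)

lemma aux_prod_coupling (α β : Measure X) [IsFiniteMeasure α] [IsFiniteMeasure β]
    (h : α univ = β univ) : ∃ π : Measure (X × X), π ∈ couplings α β := by
  by_cases h0 : α univ = 0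
  · have ha : α = 0 := Measure.measure_univ_eq_zero.mp h0
    have hb : β = 0 := Measure.measure_univ_eq_zero.mp (h ▸ h0)
    exact ⟨0, by simp [ha], by simp [hb]⟩
  · refine ⟨(α univ)⁻¹ • α.prod β, ?_, ?_⟩
    · rw [Measure.map_smul, Measure.map_fst_prod, smul_smul, ← h,
        ENNReal.inv_mul_cancel h0 (measure_ne_top _ _), one_smul]
    · rw [Measure.map_smul, Measure.map_snd_prod, smul_smul,
        ENNReal.inv_mul_cancel h0 (measure_ne_top _ _), one_smul]

lemma aux_wass_lower {p : ℝ} (hp : 1 ≤ p) (μ ν : Measure X) [IsProbabilityMeasure μ]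
    [IsProbabilityMeasure ν] (F B : Set X) (hF : MeasurableSet F) (hB : MeasurableSet B)
    (hμ : μ Bᶜ = 0) (hν : ν Fᶜ = 0) (δ : ℝ) (hδ : 0 ≤ δ)
    (hd : ∀ x ∈ B, ∀ y ∈ F, y ∉ B → δ ≤ dist x y) (hνB : 1 / 8 ≤ ν.real Bᶜ) :
    δ / 8 ≤ Wass p μ ν := by
  have hp0 : 0 < p := by linarith
  apply le_csInf
  · exact Set.Nonempty.image _ (aux_prod_coupling μ ν (by simp))
  rintro _ ⟨π, hπ, rfl⟩
  have : IsProbabilityMeasure π := ⟨by rw [aux_coupling_fin hπ]; simp⟩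
  have h1 : ∀ᵐ z ∂π, z.1 ∈ B := by
    have : π (Prod.fst ⁻¹' Bᶜ) = 0 := by
      rw [← Measure.map_apply measurable_fst hB.compl, hπ.1, hμ]
    exact this
  have h2 : ∀ᵐ z ∂π, z.2 ∈ F := by
    have : π (Prod.snd ⁻¹' Fᶜ) = 0 := by
      rw [← Measure.map_apply measurable_snd hF.compl, hπ.2, hν]
    exact this
  have h3 : δ ^ p * ν.real Bᶜ ≤ ∫ z, dist z.1 z.2 ^ p ∂π := by
    have hm : MeasurableSet (Prod.snd ⁻¹' Bᶜ : Set (X × X)) := measurable_snd hB.compl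
    have e : ν.real Bᶜ = π.real (Prod.snd ⁻¹' Bᶜ) := by
      rw [measureReal_def, measureReal_def, ← hπ.2, Measure.map_apply measurable_snd hB.compl]
    have e2 : ∫ z, (Prod.snd ⁻¹' Bᶜ : Set (X × X)).indicator (fun _ => δ ^ p) z ∂π
        = δ ^ p * ν.real Bᶜ := by
      rw [integral_indicator hm, setIntegral_const, e, smul_eq_mul, mul_comm]
    rw [← e2]
    apply integral_mono_ae ((integrable_const _).indicator hm) (aux_integrable hp π)
    filter_upwards [h1, h2] with z hz1 hz2
    by_cases hz : z.2 ∈ B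
    · rw [indicator_of_notMem (by simpa using hz)]
      positivity
    · rw [indicator_of_mem (by simpa using hz)]
      exact Real.rpow_le_rpow hδ (hd _ hz1 _ hz2 hz) hp0.le
  have h4 : (δ / 8) ^ p ≤ ∫ z, dist z.1 z.2 ^ p ∂π := by
    refine le_trans ?_ h3
    rw [Real.div_rpow hδ (by norm_num), div_eq_mul_inv]
    apply mul_le_mul_of_nonneg_left _ (by positivity)
    refine le_trans ?_ hνB
    rw [one_div]
    apply inv_anti₀ (by norm_num)
    calc (8:ℝ) = 8 ^ (1:ℝ) := by simp
      _ ≤ 8 ^ p := Real.rpow_le_rpow_of_exponent_le (by norm_num) hp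
  calc δ / 8 = ((δ / 8) ^ p) ^ (1 / p) := by
        rw [← Real.rpow_mul (by positivity), mul_one_div_cancel hp0.ne', Real.rpow_one]
    _ ≤ _ := Real.rpow_le_rpow (by positivity) h4 (by positivity)

lemma aux_wass_upper {p : ℝ} (hp : 1 ≤ p) (μ ν : Measure X) [IsProbabilityMeasure μ]
    [IsProbabilityMeasure ν] {N : ℕ} (A : Fin N → Set X) (hA : ∀ i, MeasurableSet (A i))
    (hdisj : Pairwise (Function.onFun Disjoint A)) (hcov : ⋃ i, A i = univ)
    (c : Fin N → ℝ≥0∞) (hcμ : ∀ i, c i ≤ μ (A i)) (hcν : ∀ i, c i ≤ ν (A i))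
    (ε D : ℝ) (hε : 0 ≤ ε) (hD : ∀ x y : X, dist x y ≤ D)
    (hdiam : ∀ i, ∀ x ∈ A i, ∀ y ∈ A i, dist x y ≤ ε) :
    Wass p μ ν ≤ (ε ^ p + D ^ p * (1 - ∑ i, (c i).toReal)) ^ (1 / p) := by
  have hp0 : 0 < p := by linarith
  have hD0 : 0 ≤ D := by
    obtain ⟨x⟩ : Nonempty X := by
      by_contra h
      rw [not_nonempty_iff] at h
      have := measure_univ (μ := μ)
      simp [Measure.eq_zero_of_isEmpty] at this
    simpa using hD x x
  -- decomposition of a measure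
  have key : ∀ (μ : Measure X) [IsProbabilityMeasure μ], (∀ i, c i ≤ μ (A i)) →
      ∃ (a : Fin N → Measure X) (r : Measure X), (∀ i, a i univ = c i) ∧ (∀ i, a i (A i)ᶜ = 0) ∧
        ∑ i, a i + r = μ := by
    intro μ _ hc
    have hle : ∀ i, c i / μ (A i) ≤ 1 := fun i => ENNReal.div_le_of_le_mul (by simpa using hc i)
    refine ⟨fun i => (c i / μ (A i)) • μ.restrict (A i),
      ∑ i, (1 - c i / μ (A i)) • μ.restrict (A i), ?_, ?_, ?_⟩
    · intro i
      simp only [Measure.smul_apply, Measure.restrict_apply MeasurableSet.univ, univ_inter,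
        smul_eq_mul]
      by_cases h0 : μ (A i) = 0
      · have := hc i
        rw [h0] at this ⊢
        simp at this
        simp [this]
      · exact ENNReal.div_mul_cancel h0 (measure_ne_top _ _)
    · intro i
      simp [Measure.restrict_apply (hA i).compl]
    · rw [← Finset.sum_add_distrib]
      have : ∀ i, (c i / μ (A i)) • μ.restrict (A i) + (1 - c i / μ (A i)) • μ.restrict (A i)
          = μ.restrict (A i) := by
        intro i
        rw [← add_smul, add_tsub_cancel_of_le (hle i), one_smul]
      simp_rw [this]
      rw [← Measure.sum_fintype, ← Measure.restrict_iUnion hdisj hA, hcov, Measure.restrict_univ]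
  obtain ⟨a, r, ha1, ha2, ha3⟩ := key μ hcμ
  obtain ⟨b, s, hb1, hb2, hb3⟩ := key ν hcν
  have hctop : ∀ i, c i ≠ ⊤ := fun i => ne_top_of_le_ne_top (measure_ne_top _ _) (hcμ i)
  have hfa : ∀ i, IsFiniteMeasure (a i) := fun i => ⟨by rw [ha1]; exact (hctop i).lt_top⟩
  have hfb : ∀ i, IsFiniteMeasure (b i) := fun i => ⟨by rw [hb1]; exact (hctop i).lt_top⟩
  have hr : ∑ i, c i + r univ = 1 := by
    have := congrArg (fun m : Measure X => m univ) ha3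
    simpa [ha1] using this
  have hs : ∑ i, c i + s univ = 1 := by
    have := congrArg (fun m : Measure X => m univ) hb3
    simpa [hb1] using this
  have hsum_top : ∑ i, c i ≠ ⊤ := by simp [hctop]
  have hrs : r univ = s univ := (ENNReal.add_right_inj hsum_top).mp (hr.trans hs.symm)
  have hrtop : r univ ≠ ⊤ := fun h => by simp [h] at hr
  have hfr : IsFiniteMeasure r := ⟨hrtop.lt_top⟩
  have hfs : IsFiniteMeasure s := ⟨by rw [← hrs]; exact hrtop.lt_top⟩
  choose π hπ using fun i => aux_prod_coupling (a i) (b i) (by rw [ha1, hb1])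
  obtain ⟨ρ, hρ⟩ := aux_prod_coupling r s hrs
  have hfπ : ∀ i, IsFiniteMeasure (π i) := fun i =>
    ⟨by rw [aux_coupling_fin (hπ i)]; exact measure_lt_top _ _⟩
  have hfρ : IsFiniteMeasure ρ := ⟨by rw [aux_coupling_fin hρ]; exact measure_lt_top _ _⟩
  have hmem : ∑ i, π i + ρ ∈ couplings μ ν := by
    constructor
    · rw [Measure.map_add _ _ measurable_fst, Measure.map_finset_sum measurable_fst.aemeasurable,
        hρ.1, ← ha3]
      congr 1
      exact Finset.sum_congr rfl fun i _ => (hπ i).1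
    · rw [Measure.map_add _ _ measurable_snd, Measure.map_finset_sum measurable_snd.aemeasurable,
        hρ.2, ← hb3]
      congr 1
      exact Finset.sum_congr rfl fun i _ => (hπ i).2
  have hbdd : BddBelow ((fun π : Measure (X × X) =>
      (∫ z, dist z.1 z.2 ^ p ∂π) ^ (1 / p)) '' couplings μ ν) := by
    refine ⟨0, ?_⟩
    rintro _ ⟨q, _, rfl⟩
    exact Real.rpow_nonneg (integral_nonneg fun z => by positivity) _
  refine (csInf_le hbdd ⟨_, hmem, rfl⟩).trans ?_
  refine Real.rpow_le_rpow (integral_nonneg fun z => by positivity) ?_ (by positivity)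
  have hintegr : ∀ i ∈ Finset.univ, Integrable (fun z : X × X => dist z.1 z.2 ^ p) (π i) :=
    fun i _ => aux_integrable hp _
  rw [integral_add_measure (aux_integrable hp _) (aux_integrable hp _),
    integral_finsetSum_measure hintegr]
  have hπi : ∀ i, ∫ z, dist z.1 z.2 ^ p ∂(π i) ≤ ε ^ p * (c i).toReal := by
    intro i
    have h1 : ∀ᵐ z ∂(π i), z.1 ∈ A i := by
      have : π i (Prod.fst ⁻¹' (A i)ᶜ) = 0 := by
        rw [← Measure.map_apply measurable_fst (hA i).compl, (hπ i).1, ha2]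
      exact this
    have h2 : ∀ᵐ z ∂(π i), z.2 ∈ A i := by
      have : π i (Prod.snd ⁻¹' (A i)ᶜ) = 0 := by
        rw [← Measure.map_apply measurable_snd (hA i).compl, (hπ i).2, hb2]
      exact this
    calc ∫ z, dist z.1 z.2 ^ p ∂(π i) ≤ ∫ z, ε ^ p ∂(π i) := by
          apply integral_mono_ae (aux_integrable hp _) (integrable_const _)
          filter_upwards [h1, h2] with z hz1 hz2
          exact Real.rpow_le_rpow dist_nonneg (hdiam i _ hz1 _ hz2) hp0.le
      _ = _ := by
          rw [integral_const, smul_eq_mul, mul_comm, measureReal_def, aux_coupling_fin (hπ i), ha1]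
  have hρi : ∫ z, dist z.1 z.2 ^ p ∂ρ ≤ D ^ p * (1 - ∑ i, (c i).toReal) := by
    calc ∫ z, dist z.1 z.2 ^ p ∂ρ ≤ ∫ z, D ^ p ∂ρ := by
          apply integral_mono_ae (aux_integrable hp _) (integrable_const _)
          exact Eventually.of_forall fun z => Real.rpow_le_rpow dist_nonneg (hD _ _) hp0.le
      _ = _ := by
          rw [integral_const, smul_eq_mul, mul_comm, measureReal_def, aux_coupling_fin hρ]
          congr 1
          have := congrArg ENNReal.toReal hr
          rw [ENNReal.toReal_add hsum_top hrtop, ENNReal.toReal_sum (fun i _ => hctop i)] at this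
          simp at this
          linarith
  have hsum1 : ∑ i, (c i).toReal ≤ 1 := by
    have := congrArg ENNReal.toReal hr
    rw [ENNReal.toReal_add hsum_top hrtop, ENNReal.toReal_sum (fun i _ => hctop i)] at this
    have h0 : 0 ≤ (r univ).toReal := ENNReal.toReal_nonneg
    simp at this
    linarith
  have : ∑ i, ∫ z, dist z.1 z.2 ^ p ∂(π i) ≤ ε ^ p := by
    calc _ ≤ ∑ i, ε ^ p * (c i).toReal := Finset.sum_le_sum fun i _ => hπi i
      _ = ε ^ p * ∑ i, (c i).toReal := by rw [Finset.mul_sum]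
      _ ≤ ε ^ p * 1 := by gcongr
      _ = _ := mul_one _
  linarith

lemma aux_pack_bdd {ε : ℝ} (hε : 0 < ε) : BddAbove {n | ∃ F : Finset X, F.card = n ∧
    ∀ x ∈ F, ∀ y ∈ F, x ≠ y → ε < dist x y} := by
  obtain ⟨t, -, ht, hcov⟩ := (isCompact_univ (X := X)).finite_cover_balls (half_pos hε)
  refine ⟨ht.toFinset.card, ?_⟩
  rintro _ ⟨F, rfl, hF⟩
  have : ∀ x : X, ∃ y ∈ t, dist x y < ε / 2 := by
    intro x
    have := hcov (mem_univ x)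
    simpa using this
  choose g hg1 hg2 using this
  apply Finset.card_le_card_of_injOn g
  · intro x _
    simpa using hg1 x
  · intro x hx y hy hxy
    by_contra hne
    have h1 := hF x hx y hy hne
    have h2 := dist_triangle_right x y (g x)
    have h3 := hg2 x
    have h4 := hg2 y
    rw [← hxy] at h4
    linarith

lemma aux_pack_attained {ε : ℝ} (hε : 0 < ε) : ∃ F : Finset X, F.card = packNum X ε ∧
    (∀ x ∈ F, ∀ y ∈ F, x ≠ y → ε < dist x y) ∧ ∀ x : X, ∃ y ∈ F, dist x y ≤ ε := by
  classical
  obtain ⟨F, hF1, hF2⟩ := Nat.sSup_mem (s := {n | ∃ F : Finset X, F.card = n ∧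
    ∀ x ∈ F, ∀ y ∈ F, x ≠ y → ε < dist x y}) ⟨0, ∅, by simp⟩ (aux_pack_bdd hε)
  refine ⟨F, hF1, hF2, ?_⟩
  intro x
  by_contra! hcon
  have hx : x ∉ F := by
    intro hx
    have := hcon x hx
    simp at this
    linarith
  have : (insert x F).card ≤ packNum X ε := by
    apply le_csSup (aux_pack_bdd hε)
    refine ⟨insert x F, rfl, ?_⟩
    intro a ha b hb hab
    rw [Finset.mem_insert] at ha hb
    rcases ha with rfl | ha <;> rcases hb with rfl | hb
    · exact absurd rfl hab
    · exact hcon b hb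
    · rw [dist_comm]; exact hcon a ha
    · exact hF2 a ha b hb hab
  rw [Finset.card_insert_of_notMem hx, hF1] at this
  unfold packNum at this
  omega

lemma aux_card_upper {p : ℝ} (hp : 1 ≤ p) {ε : ℝ} (hε : 0 < ε) {D : ℝ}
    (hD : ∀ x y : X, dist x y ≤ D) (hD0 : 0 ≤ D) {M : ℕ} (hM : 0 < M)
    (hMD : 2 * (packNum X (ε / 4) : ℝ) * D ^ p ≤ M * ε ^ p)
    (F : Finset (Measure X)) (hF : ↑F ⊆ {μ : Measure X | IsProbabilityMeasure μ})
    (hsep : ∀ μ ∈ F, ∀ ν ∈ F, μ ≠ ν → ε < Wass p μ ν) :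
    F.card ≤ (M + 1) ^ packNum X (ε / 4) := by
  classical
  have hp0 : 0 < p := by linarith
  obtain ⟨G, hG1, -, hG3⟩ := aux_pack_attained (X := X) (ε := ε / 4) (by positivity)
  rw [← hG1] at hMD ⊢
  set N := G.card with hN
  let e : Fin N ≃ G := G.equivFin.symm
  let A : Fin N → Set X := fun i => closedBall (e i : X) (ε / 4) ∩
    ⋂ j : Fin N, ⋂ _ : j < i, (closedBall (e j : X) (ε / 4))ᶜ
  have hA : ∀ i, MeasurableSet (A i) := fun i =>
    measurableSet_closedBall.inter (MeasurableSet.iInter fun j => MeasurableSet.iInter fun _ =>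
      measurableSet_closedBall.compl)
  have hdisj : Pairwise (Function.onFun Disjoint A) := by
    have : ∀ i j, i < j → Disjoint (A i) (A j) := by
      intro i j hij
      rw [Set.disjoint_left]
      intro x hx hx'
      have h1 := hx'.2
      simp only [mem_iInter] at h1
      exact h1 i hij hx.1
    intro i j hij
    rcases lt_or_gt_of_ne hij with h | h
    · exact this i j h
    · exact (this j i h).symm
  have hcov : ⋃ i, A i = univ := by
    rw [eq_univ_iff_forall]
    intro x
    have hex : ∃ i : Fin N, x ∈ closedBall (e i : X) (ε / 4) := by
      obtain ⟨y, hy, hxy⟩ := hG3 x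
      exact ⟨e.symm ⟨y, hy⟩, by simpa using hxy⟩
    obtain ⟨i, hi, hmin⟩ := WellFounded.has_min (wellFounded_lt (α := Fin N))
      {i : Fin N | x ∈ closedBall (e i : X) (ε / 4)} hex
    rw [mem_iUnion]
    refine ⟨i, hi, ?_⟩
    simp only [mem_iInter]
    intro j hj hjx
    exact hmin j hjx hj
  have hdiam : ∀ i, ∀ x ∈ A i, ∀ y ∈ A i, dist x y ≤ ε / 2 := by
    intro i x hx y hy
    have h1 := hx.1
    have h2 := hy.1
    rw [mem_closedBall] at h1 h2
    have := dist_triangle_right x y (e i : X)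
    linarith
  let φ : Measure X → (Fin N → Fin (M + 1)) := fun μ i =>
    Fin.ofNat (M + 1) ⌊(M : ℝ) * μ.real (A i)⌋₊
  have hφ : ∀ μ ∈ F, ∀ i, ((φ μ i : ℕ)) = ⌊(M : ℝ) * μ.real (A i)⌋₊ := by
    intro μ hμ i
    have : IsProbabilityMeasure μ := hF hμ
    have h1 : ⌊(M : ℝ) * μ.real (A i)⌋₊ ≤ M := by
      apply Nat.floor_le_of_le
      have : μ.real (A i) ≤ 1 := measureReal_le_one
      have hM' : (0:ℝ) ≤ M := by positivity
      nlinarith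
    simp only [φ, Fin.ofNat]
    exact Nat.mod_eq_of_lt (by omega)
  have hinj : Set.InjOn φ F := by
    intro μ hμ ν hν heq
    by_contra hne
    have hlt := hsep μ hμ ν hν hne
    have i1 : IsProbabilityMeasure μ := hF hμ
    have i2 : IsProbabilityMeasure ν := hF hν
    let c : Fin N → ℝ≥0∞ := fun i => ENNReal.ofReal ((φ μ i : ℕ) / M)
    have hMr : (0:ℝ) < M := by exact_mod_cast hM
    have hc : ∀ κ ∈ F, φ κ = φ μ → ∀ i, c i ≤ κ (A i) := by
      intro κ hκ h i
      have : IsProbabilityMeasure κ := hF hκ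
      rw [← ofReal_measureReal (μ := κ) (s := A i)]
      apply ENNReal.ofReal_le_ofReal
      rw [← h, hφ κ hκ, div_le_iff₀ hMr, mul_comm]
      exact Nat.floor_le (by positivity)
    have hup := aux_wass_upper hp μ ν A hA hdisj hcov c (hc μ hμ rfl) (hc ν hν heq.symm)
      (ε / 2) D (by positivity) hD hdiam
    have hsum : 1 - ∑ i, (c i).toReal ≤ N / M := by
      have h1 : ∑ i, μ.real (A i) = 1 := by
        have := measure_iUnion (μ := μ) hdisj hA
        rw [hcov, measure_univ, tsum_fintype] at this
        have h := congrArg ENNReal.toReal this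
        rw [ENNReal.toReal_sum (fun i _ => measure_ne_top _ _)] at h
        simpa [measureReal_def] using h.symm
      have h2 : ∀ i, μ.real (A i) - 1 / M ≤ (c i).toReal := by
        intro i
        rw [ENNReal.toReal_ofReal (by positivity), hφ μ hμ]
        have := (Nat.lt_floor_add_one ((M : ℝ) * μ.real (A i))).le
        rw [sub_le_iff_le_add, ← add_div, le_div_iff₀ hMr]
        linarith
      have h3 := Finset.sum_le_sum (s := Finset.univ) fun i _ => h2 i
      rw [Finset.sum_sub_distrib, h1] at h3
      simp at h3
      rw [div_eq_mul_inv]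
      linarith
    have hle : (ε / 2) ^ p + D ^ p * (1 - ∑ i, (c i).toReal) ≤ ε ^ p := by
      have h1 : (ε / 2) ^ p ≤ ε ^ p / 2 := by
        rw [Real.div_rpow hε.le (by norm_num)]
        gcongr
        calc (2:ℝ) = 2 ^ (1:ℝ) := by simp
          _ ≤ 2 ^ p := Real.rpow_le_rpow_of_exponent_le (by norm_num) hp
      have h2 : D ^ p * (1 - ∑ i, (c i).toReal) ≤ ε ^ p / 2 := by
        calc D ^ p * (1 - ∑ i, (c i).toReal) ≤ D ^ p * (N / M) := by gcongr
          _ ≤ ε ^ p / 2 := by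
            rw [mul_div_assoc', div_le_div_iff₀ hMr (by norm_num)]
            linarith
      linarith
    have hfin : Wass p μ ν ≤ ε := by
      refine hup.trans ?_
      by_cases hneg : 0 ≤ (ε / 2) ^ p + D ^ p * (1 - ∑ i, (c i).toReal)
      · calc _ ≤ (ε ^ p) ^ (1 / p) := Real.rpow_le_rpow hneg hle (by positivity)
          _ = ε := by rw [← Real.rpow_mul hε.le, mul_one_div_cancel hp0.ne', Real.rpow_one]
      · exfalso
        apply hneg
        have : ∑ i, (c i).toReal ≤ 1 := by
          have h1 : ∑ i, c i ≤ 1 := by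
            calc ∑ i, c i ≤ ∑ i, μ (A i) := Finset.sum_le_sum fun i _ => hc μ hμ rfl i
              _ = μ (⋃ i, A i) := by rw [measure_iUnion hdisj hA, tsum_fintype]
              _ = 1 := by rw [hcov, measure_univ]
          rw [← ENNReal.toReal_sum (fun i _ => by simp [c])]
          exact ENNReal.toReal_le_of_le_ofReal (by norm_num) (by simpa using h1)
        have h1 : 0 ≤ 1 - ∑ i, (c i).toReal := by linarith
        positivity
    linarith
  have := Finset.card_le_card_of_injOn (t := Finset.univ) φ (fun _ _ => by simp) hinj
  simpa using this

lemma aux_family_lower {p : ℝ} (hp : 1 ≤ p) {ε : ℝ} (hε : 0 < ε) :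
    ∃ F : Finset (Measure X), ↑F ⊆ {μ : Measure X | IsProbabilityMeasure μ} ∧
      (∀ μ ∈ F, ∀ ν ∈ F, μ ≠ ν → ε < Wass p μ ν) ∧
      ((packNum X (16 * ε) / 2 : ℕ) : ℝ) * (Real.log 2 / 4) ≤ Real.log F.card := by
  classical
  obtain ⟨G, hG1, hG2, -⟩ := aux_pack_attained (X := X) (ε := 16 * ε) (by positivity)
  rw [← hG1]
  set m := G.card / 2 with hm
  by_cases hm0 : m = 0
  · exact ⟨∅, by simp, by simp, by simp [hm0]⟩
  have hmr : (0:ℝ) < m := by exact_mod_cast Nat.pos_of_ne_zero hm0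
  obtain ⟨e⟩ : Nonempty (Fin m × Bool ↪ G) := by
    apply Function.Embedding.nonempty_of_card_le
    simp
    omega
  obtain ⟨C, hC1, hC2⟩ := aux_code m
  let μ : (Fin m → Bool) → Measure X := fun w =>
    (m : ℝ≥0∞)⁻¹ • ∑ j, Measure.dirac (e (j, w j) : X)
  let B : (Fin m → Bool) → Set X := fun w => range fun j => (e (j, w j) : X)
  have hBfin : ∀ w, (B w).Finite := fun w => finite_range _
  have hBm : ∀ w, MeasurableSet (B w) := fun w => (hBfin w).measurableSet
  have hprob : ∀ w, IsProbabilityMeasure (μ w) := by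
    intro w
    constructor
    simp only [μ, Measure.smul_apply, Measure.finsetSum_apply, measure_univ, smul_eq_mul]
    simp
    exact ENNReal.inv_mul_cancel (by exact_mod_cast hm0) (by simp)
  have hmem : ∀ (v w : Fin m → Bool) (j : Fin m), (e (j, v j) : X) ∈ B w ↔ w j = v j := by
    intro v w j
    constructor
    · rintro ⟨k, hk⟩
      have := e.injective (Subtype.ext hk)
      simp only [Prod.mk.injEq] at this
      obtain ⟨rfl, h⟩ := this
      exact h
    · intro h
      exact ⟨j, by simp [h]⟩
  have hval : ∀ v w, (μ v).real (B w)ᶜ = hammingDist w v / m := by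
    intro v w
    have : μ v (B w)ᶜ = (m : ℝ≥0∞)⁻¹ * hammingDist w v := by
      simp only [μ, Measure.smul_apply, Measure.finsetSum_apply, smul_eq_mul]
      congr 1
      have h1 : ∀ j, Measure.dirac (e (j, v j) : X) (B w)ᶜ = if w j ≠ v j then 1 else 0 := by
        intro j
        rw [Measure.dirac_apply' _ (hBm w).compl]
        by_cases h : w j = v j
        · rw [indicator_of_notMem (by simpa using (hmem v w j).mpr h)]
          simp [h]
        · rw [indicator_of_mem (by simpa using (not_congr (hmem v w j)).mpr h)]
          simp [h]
      rw [Finset.sum_congr rfl fun j _ => h1 j]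
      rw [Finset.sum_boole]
      rfl
    rw [measureReal_def, this]
    simp [div_eq_mul_inv, mul_comm]
  have hge : ∀ v ∈ C, ∀ w ∈ C, w ≠ v → 1 / 8 ≤ (μ v).real (B w)ᶜ := by
    intro v hv w hw hne
    rw [hval, div_le_div_iff₀ (by norm_num) hmr]
    have : (m : ℝ) ≤ 8 * hammingDist w v := by exact_mod_cast hC1 w hw v hv hne
    linarith
  have hself : ∀ w, μ w (B w)ᶜ = 0 := by
    intro w
    have := hval w w
    simp only [hammingDist_self, Nat.cast_zero, zero_div] at this
    have hp := hprob w
    exact (measureReal_eq_zero_iff).mp this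
  have hinj : Set.InjOn μ C := by
    intro v hv w hw h
    by_contra hne
    have h1 := hge v hv w hw (Ne.symm hne)
    rw [h, measureReal_def, hself] at h1
    norm_num at h1
  refine ⟨C.image μ, ?_, ?_, ?_⟩
  · intro x hx
    simp only [Finset.coe_image, mem_image] at hx
    obtain ⟨w, _, rfl⟩ := hx
    exact hprob w
  · intro x hx y hy hxy
    rw [Finset.mem_image] at hx hy
    obtain ⟨w, hw, rfl⟩ := hx
    obtain ⟨v, hv, rfl⟩ := hy
    have hne : w ≠ v := fun h => hxy (by rw [h])
    have i1 := hprob w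
    have i2 := hprob v
    have hsub : ∀ w, B w ⊆ (G : Set X) := by
      rintro w _ ⟨j, rfl⟩
      exact (e (j, w j)).2
    have := aux_wass_lower hp (μ w) (μ v) (G : Set X) (B w) G.measurableSet (hBm w) (hself w)
      (measure_mono_null (compl_subset_compl.mpr (hsub v)) (hself v)) (16 * ε) (by positivity)
      (fun x hx y hy hyB => (hG2 x (hsub w hx) y hy (fun h => hyB (h ▸ hx))).le)
      (hge v hv w hw hne)
    linarith
  · rw [Finset.card_image_of_injOn hinj]
    exact hC2

lemma aux_exists_bound (X : Type*) [MetricSpace X] [CompactSpace X] :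
    ∃ D : ℝ, 0 ≤ D ∧ ∀ x y : X, dist x y ≤ D :=
  ⟨Metric.diam (univ : Set X), Metric.diam_nonneg, fun x y =>
    Metric.dist_le_diam_of_mem isCompact_univ.isBounded (mem_univ x) (mem_univ y)⟩

lemma aux_packWass_bdd {p : ℝ} (hp : 1 ≤ p) {ε : ℝ} (hε : 0 < ε) :
    BddAbove {n | ∃ F : Finset (Measure X), ↑F ⊆ {μ : Measure X | IsProbabilityMeasure μ} ∧
      F.card = n ∧ ∀ μ ∈ F, ∀ ν ∈ F, μ ≠ ν → ε < Wass p μ ν} := by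
  obtain ⟨D, hD0, hD⟩ := aux_exists_bound X
  obtain ⟨M, hM⟩ := exists_nat_ge (2 * (packNum X (ε / 4) : ℝ) * D ^ p / ε ^ p)
  refine ⟨(M + 1 + 1) ^ packNum X (ε / 4), ?_⟩
  rintro _ ⟨F, hF, rfl, hsep⟩
  refine aux_card_upper hp hε hD hD0 (Nat.succ_pos M) ?_ F hF hsep
  have hpos : 0 < ε ^ p := by positivity
  rw [div_le_iff₀ hpos] at hM
  push_cast
  nlinarith

lemma aux_upper_log (X : Type*) [MetricSpace X] [CompactSpace X] [MeasurableSpace X]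
    [BorelSpace X] {p : ℝ} (hp : 1 ≤ p) : ∃ K : ℝ, 0 ≤ K ∧ ∀ ε : ℝ, 0 < ε → ε < 1 →
    Real.log (Real.log (packWass p {μ : Measure X | IsProbabilityMeasure μ} ε)) ≤
      2 * Real.log (packNum X (ε / 4)) + p * (-Real.log ε) + K := by
  obtain ⟨D, hD0, hD⟩ := aux_exists_bound X
  have hDp : 0 ≤ D ^ p := by positivity
  have hK : 0 ≤ Real.log (2 * D ^ p + 2) := Real.log_nonneg (by linarith)
  refine ⟨Real.log (2 * D ^ p + 2), hK, ?_⟩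
  intro ε hε hε1
  have hL : 0 ≤ -Real.log ε := by
    have := Real.log_neg hε hε1
    linarith
  have hpL : 0 ≤ p * (-Real.log ε) := mul_nonneg (by linarith) hL
  set N := packNum X (ε / 4) with hN
  set P := packWass p {μ : Measure X | IsProbabilityMeasure μ} ε with hP
  have hpos : 0 < ε ^ p := by positivity
  set M := ⌊2 * (N : ℝ) * D ^ p / ε ^ p⌋₊ + 1 with hM
  have hMpos : 0 < M := Nat.succ_pos _
  have hMge : 2 * (N : ℝ) * D ^ p ≤ M * ε ^ p := by
    rw [← div_le_iff₀ hpos, hM]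
    push_cast
    exact (Nat.lt_floor_add_one _).le
  have hPle : P ≤ (M + 1) ^ N := by
    refine csSup_le (s := {n | ∃ F : Finset (Measure X),
      ↑F ⊆ {μ : Measure X | IsProbabilityMeasure μ} ∧ F.card = n ∧
      ∀ μ ∈ F, ∀ ν ∈ F, μ ≠ ν → ε < Wass p μ ν}) ⟨0, ∅, by simp⟩ ?_
    rintro _ ⟨F, hF, rfl, hsep⟩
    exact aux_card_upper hp hε hD hD0 hMpos hMge F hF hsep
  have hlogN : 0 ≤ Real.log N := Real.log_natCast_nonneg N
  by_cases hP1 : P ≤ 1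
  · have : Real.log P = 0 := by
      interval_cases P <;> simp
    rw [this, Real.log_zero]
    linarith
  push Not at hP1
  have hN0 : N ≠ 0 := by
    intro h
    rw [h] at hPle
    simp at hPle
    omega
  have hN1 : (1:ℝ) ≤ N := by exact_mod_cast Nat.one_le_iff_ne_zero.mpr hN0
  have hM1 : (0:ℝ) < M := by exact_mod_cast hMpos
  have hPr : (1:ℝ) < P := by exact_mod_cast hP1
  have h1 : Real.log P ≤ N * M := by
    calc Real.log P ≤ Real.log (((M : ℝ) + 1) ^ N) := by
          apply Real.log_le_log (by linarith)
          exact_mod_cast hPle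
      _ = N * Real.log ((M:ℝ) + 1) := Real.log_pow _ _
      _ ≤ N * M := by
          gcongr
          have := Real.log_le_sub_one_of_pos (x := (M:ℝ) + 1) (by positivity)
          linarith
  have hMle : (M : ℝ) ≤ N * (ε ^ p)⁻¹ * (2 * D ^ p + 2) := by
    have hf : (⌊2 * (N : ℝ) * D ^ p / ε ^ p⌋₊ : ℝ) ≤ 2 * (N : ℝ) * D ^ p / ε ^ p :=
      Nat.floor_le (by positivity)
    have hinv : 1 ≤ (ε ^ p)⁻¹ := by
      rw [one_le_inv₀ hpos]
      exact Real.rpow_le_one hε.le hε1.le (by linarith)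
    have hNi : 1 ≤ N * (ε ^ p)⁻¹ := by nlinarith
    rw [hM]
    push_cast
    have hf' : 2 * (N : ℝ) * D ^ p / ε ^ p = 2 * D ^ p * (N * (ε ^ p)⁻¹) := by
      rw [div_eq_mul_inv]; ring
    nlinarith
  calc Real.log (Real.log P) ≤ Real.log (N * (N * (ε ^ p)⁻¹ * (2 * D ^ p + 2))) := by
        apply Real.log_le_log (Real.log_pos hPr)
        refine h1.trans ?_
        gcongr
    _ = _ := by
        rw [Real.log_mul (by positivity) (by positivity), Real.log_mul (by positivity) (by positivity),
          Real.log_mul (by positivity) (by positivity), Real.log_inv, Real.log_rpow hε]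
        ring

lemma aux_lower_log (X : Type*) [MetricSpace X] [CompactSpace X] [MeasurableSpace X]
    [BorelSpace X] {p : ℝ} (hp : 1 ≤ p) : ∃ K : ℝ, 0 ≤ K ∧ ∀ ε : ℝ, 0 < ε →
    Real.log (packNum X (16 * ε)) - K ≤
    Real.log (Real.log (packWass p {μ : Measure X | IsProbabilityMeasure μ} ε)) := by
  refine ⟨|Real.log (Real.log 2 / 12)| + |Real.log (Real.log 2)|, by positivity, ?_⟩
  intro ε hε
  set N := packNum X (16 * ε) with hN
  set P := packWass p {μ : Measure X | IsProbabilityMeasure μ} ε with hP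
  have a1 := neg_abs_le (Real.log (Real.log 2 / 12))
  have a2 := neg_abs_le (Real.log (Real.log 2))
  have a3 := abs_nonneg (Real.log (Real.log 2 / 12))
  have a4 := abs_nonneg (Real.log (Real.log 2))
  have hl2 : 0 < Real.log 2 := Real.log_pos (by norm_num)
  by_cases hN2 : N < 2
  · have hNl : Real.log N = 0 := by interval_cases N <;> simp
    by_cases hP2 : P < 2
    · have : Real.log P = 0 := by interval_cases P <;> simp
      rw [this, hNl, Real.log_zero]
      linarith
    · push Not at hP2
      have : Real.log (Real.log 2) ≤ Real.log (Real.log P) := by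
        apply Real.log_le_log hl2
        apply Real.log_le_log (by norm_num)
        exact_mod_cast hP2
      linarith
  · push Not at hN2
    obtain ⟨F, hF1, hF2, hF3⟩ := aux_family_lower (X := X) hp hε
    have hcard : F.card ≤ P := le_csSup (aux_packWass_bdd hp hε) ⟨F, hF1, rfl, hF2⟩
    rw [← hN] at hF3
    have hNpos : (0:ℝ) < N := by exact_mod_cast (by omega : 0 < N)
    have hm : (N : ℝ) / 3 ≤ ((N / 2 : ℕ) : ℝ) := by
      have : N ≤ 3 * (N / 2) := by omega
      have : (N : ℝ) ≤ 3 * ((N / 2 : ℕ) : ℝ) := by exact_mod_cast this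
      linarith
    have h1 : N * (Real.log 2 / 12) ≤ Real.log F.card := by
      refine le_trans ?_ hF3
      nlinarith
    have h0 : 0 < N * (Real.log 2 / 12) := by positivity
    have hFpos : (0:ℝ) < F.card := by
      rcases Nat.eq_zero_or_pos F.card with h | h
      · rw [h] at h1
        simp at h1
        linarith
      · exact_mod_cast h
    have h2 : N * (Real.log 2 / 12) ≤ Real.log P := by
      refine h1.trans (Real.log_le_log hFpos ?_)
      exact_mod_cast hcard
    have h3 := Real.log_le_log h0 h2
    rw [Real.log_mul (by positivity) (by positivity)] at h3
    linarith

lemma aux_ev_log (T : ℝ) : ∀ᶠ ε in nhdsWithin (0:ℝ) (Ioi 0), T ≤ -Real.log ε := by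
  have := Real.tendsto_log_nhdsGT_zero
  filter_upwards [this.eventually_le_atBot (-T)] with ε h
  linarith

lemma aux_ev_scale {k : ℝ} (hk : 0 < k) {q : ℝ → Prop}
    (h : ∀ᶠ ε in nhdsWithin (0:ℝ) (Ioi 0), q ε) :
    ∀ᶠ ε in nhdsWithin (0:ℝ) (Ioi 0), q (k * ε) := by
  have : Tendsto (fun ε : ℝ => k * ε) (nhdsWithin 0 (Ioi 0)) (nhdsWithin 0 (Ioi 0)) := by
    apply tendsto_nhdsWithin_of_tendsto_nhds_of_eventually_within
    · have : Tendsto (fun ε : ℝ => k * ε) (nhds 0) (nhds (k * 0)) := (continuous_const_mul k).tendsto 0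
      rw [mul_zero] at this
      exact this.mono_left nhdsWithin_le_nhds
    · filter_upwards [self_mem_nhdsWithin] with ε hε
      exact mul_pos hk hε
  exact this.eventually h

end aux

theorem stmt8 (X : Type*) [MetricSpace X] [CompactSpace X] [MeasurableSpace X] [BorelSpace X]
    (p : ℝ) (hp : 1 ≤ p) :
    liminf (fun ε : ℝ => Real.log (packNum X ε) / (-Real.log ε)) (nhdsWithin 0 (Set.Ioi 0)) ≤
      liminf (fun ε : ℝ =>
          Real.log (Real.log (packWass p {μ : Measure X | IsProbabilityMeasure μ} ε)) /
            (-Real.log ε)) (nhdsWithin 0 (Set.Ioi 0)) := by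
  obtain ⟨K, hK0, hK⟩ := aux_lower_log X hp
  obtain ⟨K', hK'0, hK'⟩ := aux_upper_log X hp
  rw [liminf_eq, liminf_eq]
  set Sf := {a : ℝ | ∀ᶠ ε in nhdsWithin 0 (Set.Ioi 0),
    a ≤ Real.log (packNum X ε) / (-Real.log ε)} with hSf
  set Sg := {a : ℝ | ∀ᶠ ε in nhdsWithin 0 (Set.Ioi 0),
    a ≤ Real.log (Real.log (packWass p {μ : Measure X | IsProbabilityMeasure μ} ε)) /
      (-Real.log ε)} with hSg
  have h0 : (0:ℝ) ∈ Sf := by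
    filter_upwards [aux_ev_log 0] with ε h
    exact div_nonneg (Real.log_natCast_nonneg _) h
  have hlow : ∀ a ∈ Sf, ∀ a' < a, a' ∈ Sg := by
    intro a ha a' haa
    have hd : 0 < a - a' := by linarith
    filter_upwards [aux_ev_scale (k := 16) (by norm_num) ha, self_mem_nhdsWithin, aux_ev_log 1,
      aux_ev_log ((|a| * Real.log 16 + K) / (a - a')), aux_ev_log (Real.log 16 + 1)]
      with ε h1 hε h2 h3 h4
    have hε' : (0:ℝ) < ε := hε
    rw [Real.log_mul (by norm_num) hε'.ne', le_div_iff₀ (by linarith)] at h1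
    rw [div_le_iff₀ hd] at h3
    rw [le_div_iff₀ (by linarith)]
    have h5 := hK ε hε'
    have h6 : a * Real.log 16 ≤ |a| * Real.log 16 :=
      mul_le_mul_of_nonneg_right (le_abs_self a) (Real.log_nonneg (by norm_num))
    nlinarith
  by_cases hb : BddAbove Sf
  · have hbg : BddAbove Sg := by
      obtain ⟨Bd, hBd⟩ := hb
      refine ⟨max p (p + 4 * (Bd + 1)), ?_⟩
      intro b hbS
      by_contra hcon
      rw [not_le, max_lt_iff] at hcon
      have hmem : (b - p) / 4 - 1 ∈ Sf := by
        filter_upwards [aux_ev_scale (k := 4) (by norm_num) hbS, self_mem_nhdsWithin,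
          aux_ev_scale (k := 4) (by norm_num) (aux_ev_log 1),
          aux_ev_scale (k := 4) (by norm_num) (aux_ev_log (Real.log 4)),
          aux_ev_scale (k := 4) (by norm_num) (aux_ev_log K')] with η h1 hη h2 h3 h4
        have hη' : (0:ℝ) < η := hη
        have hlt : 4 * η < 1 := by
          by_contra hge
          have := Real.log_nonneg (not_lt.mp hge)
          linarith
        have h5 := hK' (4 * η) (by positivity) hlt
        rw [mul_div_cancel_left₀ η (by norm_num : (4:ℝ) ≠ 0)] at h5
        rw [le_div_iff₀ (by linarith)] at h1
        have hl4 : 0 ≤ Real.log 4 := Real.log_nonneg (by norm_num)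
        have hlog : -Real.log η = -Real.log (4 * η) + Real.log 4 := by
          rw [Real.log_mul (by norm_num) hη'.ne']; ring
        rw [hlog, le_div_iff₀ (by linarith)]
        set L := -Real.log (4 * η)
        have h6 : (b - p) * Real.log 4 ≤ (b - p) * L :=
          mul_le_mul_of_nonneg_left h3 (by linarith)
        nlinarith
      have := hBd hmem
      linarith
    apply csSup_le ⟨0, h0⟩
    intro a ha
    apply le_of_forall_lt
    intro a' haa
    obtain ⟨a'', h1, h2⟩ := exists_between haa
    exact h1.trans_le (le_csSup hbg (hlow a ha a'' h2))
  · rw [Real.sSup_of_not_bddAbove hb]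
    by_cases hbg : BddAbove Sg
    · apply le_of_forall_lt
      intro a' haa
      obtain ⟨a'', h1, h2⟩ := exists_between haa
      exact h1.trans_le (le_csSup hbg (hlow 0 h0 a'' h2))
    · rw [Real.sSup_of_not_bddAbove hbg]
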